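/- arXiv:2406.12261 — 2 statements merged into one kernel-verified Lean document; each statement's English description precedes it below -/
import Mathlib

section
/- Let A be a coalgebra over k, let ρ be a comodule structure on M, and let C ⊆ A be a subcoalgebra. Then the largest C-subcomodule M_C of M has underlying subspace exactly the preimage ρ⁻¹(M ⊗ C) = {m ∈ M : ρ(m) ∈ M ⊗ C}; equivalently, ρ maps the subspace V := {m ∈ M : ρ(m) ∈ M ⊗ C} into V ⊗ C. (Proposition 3.1(2) of the paper.) -/
open TensorProduct

/-- The image in `M ⊗[k] A` of `N ⊗[k] X` under the tensor product of the inclusion maps. -/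
noncomputable def tmulSub {k M A : Type*} [Field k] [AddCommGroup M] [Module k M]
    [AddCommGroup A] [Module k A] (N : Submodule k M) (X : Submodule k A) :
    Submodule k (M ⊗[k] A) :=
  LinearMap.range (TensorProduct.map N.subtype X.subtype)

/-- `M_X`: the supremum of all `X`-subcomodules of `M`. -/
noncomputable def subMX {k M A : Type*} [Field k] [AddCommGroup M] [Module k M]
    [AddCommGroup A] [Module k A] (ρ : M →ₗ[k] M ⊗[k] A) (X : Submodule k A) :
    Submodule k M :=
  sSup {N : Submodule k M | ∀ n ∈ N, ρ n ∈ tmulSub N X}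

theorem mem_tmulSub_top {k M A : Type*} [Field k] [AddCommGroup M] [Module k M]
    [AddCommGroup A] [Module k A] (C : Submodule k A) (x : M ⊗[k] A) :
    x ∈ tmulSub (⊤ : Submodule k M) C ↔ x ∈ LinearMap.range (LinearMap.lTensor M C.subtype) := by
  have e : TensorProduct.map (⊤ : Submodule k M).subtype C.subtype =
      (LinearMap.lTensor M C.subtype) ∘ₗ (LinearMap.rTensor C (⊤ : Submodule k M).subtype) := by
    ext; simp
  have hs : Function.Surjective (LinearMap.rTensor C (⊤ : Submodule k M).subtype) :=
    LinearMap.rTensor_surjective C (fun x => ⟨⟨x, trivial⟩, rfl⟩)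
  unfold tmulSub
  rw [e, LinearMap.range_comp_of_range_eq_top _ (LinearMap.range_eq_top.2 hs)]

theorem mem_tmulSub_top' {k M A : Type*} [Field k] [AddCommGroup M] [Module k M]
    [AddCommGroup A] [Module k A] (C : Submodule k A) (x : M ⊗[k] A) :
    x ∈ tmulSub (⊤ : Submodule k M) C ↔ LinearMap.lTensor M C.mkQ x = 0 := by
  rw [mem_tmulSub_top]
  exact (lTensor_exact M (LinearMap.exact_subtype_mkQ C) (Submodule.mkQ_surjective C) x).symm

theorem tmulSub_mono {k M A : Type*} [Field k] [AddCommGroup M] [Module k M]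
    [AddCommGroup A] [Module k A] (N N' : Submodule k M) (h : N ≤ N') (C : Submodule k A) :
    tmulSub N C ≤ tmulSub N' C := by
  rintro _ ⟨y, rfl⟩
  refine ⟨LinearMap.rTensor C (Submodule.inclusion h) y, ?_⟩
  rw [← LinearMap.comp_apply]
  congr 1
  ext; simp

theorem key_6 {k M A : Type*} [Field k] [AddCommGroup M] [Module k M]
    [AddCommGroup A] [Module k A] [Coalgebra k A]
    (ρ : M →ₗ[k] M ⊗[k] A)
    (hcoassoc : (TensorProduct.assoc k M A A).toLinearMap ∘ₗ (LinearMap.rTensor A ρ) ∘ₗ ρ =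
      (LinearMap.lTensor M (Coalgebra.comul (R := k) (A := A))) ∘ₗ ρ)
    (C : Submodule k A)
    (hC : ∀ c ∈ C, Coalgebra.comul (R := k) c ∈ tmulSub C C) :
    ∀ m ∈ Submodule.comap ρ (tmulSub (⊤ : Submodule k M) C),
      ρ m ∈ tmulSub (Submodule.comap ρ (tmulSub (⊤ : Submodule k M) C)) C := by
  intro m hm
  let g : M →ₗ[k] M ⊗[k] (A ⧸ C) := LinearMap.lTensor M C.mkQ ∘ₗ ρ
  have hV : Submodule.comap ρ (tmulSub (⊤ : Submodule k M) C) = LinearMap.ker g := by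
    ext x
    rw [Submodule.mem_comap, mem_tmulSub_top', LinearMap.mem_ker]; rfl
  obtain ⟨y, hy⟩ := (mem_tmulSub_top C _).1 (Submodule.mem_comap.1 hm)
  rw [hV]
  have hzero : (LinearMap.rTensor A C.mkQ) ∘ₗ (Coalgebra.comul (R := k) (A := A)) ∘ₗ C.subtype
      = 0 := by
    ext c
    obtain ⟨z, hz⟩ := hC c c.2
    have : (LinearMap.rTensor A C.mkQ) ∘ₗ TensorProduct.map C.subtype C.subtype = 0 := by
      ext a b
      simp [(Submodule.Quotient.mk_eq_zero C).2 a.2]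
    have h := LinearMap.congr_fun this z
    rw [LinearMap.comp_apply, hz] at h
    exact h
  have h1 : LinearMap.rTensor A g (ρ m) = 0 := by
    have e : (TensorProduct.assoc k M (A ⧸ C) A).toLinearMap ∘ₗ
        LinearMap.rTensor A (LinearMap.lTensor M C.mkQ) =
        LinearMap.lTensor M (LinearMap.rTensor A C.mkQ) ∘ₗ
          (TensorProduct.assoc k M A A).toLinearMap := by
      ext; simp
    apply (TensorProduct.assoc k M (A ⧸ C) A).injective
    rw [map_zero]
    have e1 := LinearMap.congr_fun e (LinearMap.rTensor A ρ (ρ m))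
    have e2 := LinearMap.congr_fun hcoassoc m
    simp only [LinearMap.comp_apply, LinearEquiv.coe_coe] at e1 e2
    rw [LinearMap.rTensor_comp, LinearMap.comp_apply, e1, e2, ← hy, ← LinearMap.comp_apply,
      ← LinearMap.comp_apply, ← LinearMap.lTensor_comp, ← LinearMap.lTensor_comp,
      LinearMap.comp_assoc, hzero]
    simp
  have h2 : LinearMap.rTensor C g y = 0 := by
    apply Module.Flat.lTensor_preserves_injective_linearMap (M := M ⊗[k] (A ⧸ C)) C.subtype
      C.injective_subtype
    rw [map_zero, ← LinearMap.comp_apply, LinearMap.lTensor_comp_rTensor,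
      ← LinearMap.rTensor_comp_lTensor, LinearMap.comp_apply, hy, h1]
  obtain ⟨w, hw⟩ := (Module.Flat.rTensor_exact C (LinearMap.exact_subtype_ker_map g) y).1 h2
  refine ⟨w, ?_⟩
  rw [← hy, ← hw, ← LinearMap.comp_apply, LinearMap.lTensor_comp_rTensor]

/-- Proposition 3.1(2): for a comodule `M` over a coalgebra `A` and a subcoalgebra `C ⊆ A`,
the largest `C`-subcomodule `M_C` of `M` equals the preimage `ρ⁻¹(M ⊗ C)`; equivalently,
`ρ` maps `V = {m : ρ m ∈ M ⊗ C}` into `V ⊗ C`. -/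
theorem stmt_6 {k M A : Type*} [Field k] [AddCommGroup M] [Module k M]
    [AddCommGroup A] [Module k A] [Coalgebra k A]
    (ρ : M →ₗ[k] M ⊗[k] A)
    (hcoassoc : (TensorProduct.assoc k M A A).toLinearMap ∘ₗ (LinearMap.rTensor A ρ) ∘ₗ ρ =
      (LinearMap.lTensor M (Coalgebra.comul (R := k) (A := A))) ∘ₗ ρ)
    (hcounit : (TensorProduct.rid k M).toLinearMap ∘ₗ
      (LinearMap.lTensor M (Coalgebra.counit (R := k) (A := A))) ∘ₗ ρ = LinearMap.id)
    (C : Submodule k A)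
    (hC : ∀ c ∈ C, Coalgebra.comul (R := k) c ∈ tmulSub C C) :
    subMX ρ C = Submodule.comap ρ (tmulSub (⊤ : Submodule k M) C) ∧
    (∀ m ∈ Submodule.comap ρ (tmulSub (⊤ : Submodule k M) C),
      ρ m ∈ tmulSub (Submodule.comap ρ (tmulSub (⊤ : Submodule k M) C)) C) := by
  have key := key_6 ρ hcoassoc C hC
  refine ⟨le_antisymm (sSup_le fun N hN n hn => ?_) (le_sSup key), key⟩
  exact tmulSub_mono N ⊤ le_top C (hN n hn)
end

section
/- Let ρ_M and ρ_N be coactions on M and N, and let X, Y ⊆ A be subspaces. Then the image of M_X ⊗[k] N_Y in M ⊗[k] N is contained in (M ⊗ N)_{X·Y}, the supremum of all (X·Y)-subcomodules of M ⊗ N with respect to the tensor coaction ρ_{M⊗N}; concretely, ρ_{M⊗N} maps the image of M_X ⊗ N_Y into (image of M_X ⊗ N_Y) ⊗ (X·Y). (Proposition 3.4(1) of the paper.) -/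
open TensorProduct

/-- The tensor coaction on `M ⊗ N`:
`(id_M ⊗ id_N ⊗ μ) ∘ (id_M ⊗ τ ⊗ id_A) ∘ (ρ_M ⊗ ρ_N)`. -/
noncomputable def tensorCoaction {k A M N : Type*} [Field k] [CommRing A] [Algebra k A]
    [AddCommGroup M] [Module k M] [AddCommGroup N] [Module k N]
    (ρM : M →ₗ[k] M ⊗[k] A) (ρN : N →ₗ[k] N ⊗[k] A) :
    M ⊗[k] N →ₗ[k] (M ⊗[k] N) ⊗[k] A :=
  (LinearMap.lTensor (M ⊗[k] N) (LinearMap.mul' k A)) ∘ₗ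
    (TensorProduct.tensorTensorTensorComm k M A N A).toLinearMap ∘ₗ
      (TensorProduct.map ρM ρN)

theorem aux_tmul_mem {k M A : Type*} [Field k] [AddCommGroup M] [Module k M]
    [AddCommGroup A] [Module k A] {N : Submodule k M} {X : Submodule k A} {n : M} {a : A}
    (hn : n ∈ N) (ha : a ∈ X) : n ⊗ₜ[k] a ∈ tmulSub N X :=
  ⟨(⟨n, hn⟩ : N) ⊗ₜ[k] (⟨a, ha⟩ : X), by simp⟩

theorem aux_tmulSub_le {k M A : Type*} [Field k] [AddCommGroup M] [Module k M]
    [AddCommGroup A] [Module k A] {N : Submodule k M} {X : Submodule k A}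
    {P : Submodule k (M ⊗[k] A)} (h : ∀ n ∈ N, ∀ a ∈ X, n ⊗ₜ[k] a ∈ P) :
    tmulSub N X ≤ P := by
  rintro _ ⟨t, rfl⟩
  induction t with
  | zero => simp
  | tmul n a => simpa using h n n.2 a a.2
  | add x y hx hy => rw [map_add]; exact P.add_mem hx hy

theorem aux_subMX {k M A : Type*} [Field k] [AddCommGroup M] [Module k M]
    [AddCommGroup A] [Module k A] (ρ : M →ₗ[k] M ⊗[k] A) (X : Submodule k A) :
    ∀ m ∈ subMX ρ X, ρ m ∈ tmulSub (subMX ρ X) X := by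
  have h : subMX ρ X ≤ (tmulSub (subMX ρ X) X).comap ρ := by
    refine sSup_le fun N hN n hn => ?_
    refine aux_tmulSub_le (P := tmulSub (subMX ρ X) X) (fun n hn a ha => ?_) (hN n hn)
    exact aux_tmul_mem (le_sSup (a := N) hN hn) ha
  exact h

/-- Proposition 3.4(1): the image of `M_X ⊗ N_Y` in `M ⊗ N` is an `(X·Y)`-subcomodule for
the tensor coaction, hence is contained in `(M ⊗ N)_{X·Y}`. -/
theorem stmt_15 {k A M N : Type*} [Field k] [CommRing A] [Algebra k A]
    [AddCommGroup M] [Module k M] [AddCommGroup N] [Module k N]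
    (ρM : M →ₗ[k] M ⊗[k] A) (ρN : N →ₗ[k] N ⊗[k] A)
    (X Y : Submodule k A) :
    (∀ t ∈ LinearMap.range (TensorProduct.map (subMX ρM X).subtype (subMX ρN Y).subtype),
      tensorCoaction ρM ρN t ∈
        tmulSub
          (LinearMap.range (TensorProduct.map (subMX ρM X).subtype (subMX ρN Y).subtype))
          (Submodule.span k {a : A | ∃ x ∈ X, ∃ y ∈ Y, a = x * y})) ∧
    LinearMap.range (TensorProduct.map (subMX ρM X).subtype (subMX ρN Y).subtype) ≤
      subMX (tensorCoaction ρM ρN)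
        (Submodule.span k {a : A | ∃ x ∈ X, ∃ y ∈ Y, a = x * y}) := by
  have key : ∀ t ∈ tmulSub (subMX ρM X) (subMX ρN Y),
      tensorCoaction ρM ρN t ∈ tmulSub (tmulSub (subMX ρM X) (subMX ρN Y))
        (Submodule.span k {a : A | ∃ x ∈ X, ∃ y ∈ Y, a = x * y}) := by
    set Q := tmulSub (tmulSub (subMX ρM X) (subMX ρN Y))
        (Submodule.span k {a : A | ∃ x ∈ X, ∃ y ∈ Y, a = x * y}) with hQ
    let F : (M ⊗[k] A) ⊗[k] (N ⊗[k] A) →ₗ[k] (M ⊗[k] N) ⊗[k] A :=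
      (LinearMap.lTensor (M ⊗[k] N) (LinearMap.mul' k A)) ∘ₗ
        (TensorProduct.tensorTensorTensorComm k M A N A).toLinearMap
    have hF : ∀ u ∈ tmulSub (subMX ρM X) X, ∀ v ∈ tmulSub (subMX ρN Y) Y, F (u ⊗ₜ v) ∈ Q := by
      intro u hu v hv
      refine aux_tmulSub_le (P := Q.comap (F ∘ₗ (TensorProduct.mk k _ _).flip v)) ?_ hu
      intro m hm x hx
      refine aux_tmulSub_le
        (P := Q.comap (F ∘ₗ (TensorProduct.mk k (M ⊗[k] A) (N ⊗[k] A)) (m ⊗ₜ x))) ?_ hv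
      intro n hn y hy
      have : F ((m ⊗ₜ x) ⊗ₜ (n ⊗ₜ y)) = (m ⊗ₜ n) ⊗ₜ (x * y) := by simp [F]
      change F ((m ⊗ₜ x) ⊗ₜ (n ⊗ₜ y)) ∈ Q
      rw [this]
      exact aux_tmul_mem (aux_tmul_mem hm hn) (Submodule.subset_span ⟨x, hx, y, hy, rfl⟩)
    intro t ht
    refine aux_tmulSub_le (P := Q.comap (tensorCoaction ρM ρN)) ?_ ht
    intro m hm n hn
    exact hF _ (aux_subMX ρM X m hm) _ (aux_subMX ρN Y n hn)
  exact ⟨key, le_sSup (a := tmulSub (subMX ρM X) (subMX ρN Y)) key⟩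
end
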